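/- arXiv:1707.08891 — 6 statements merged into one kernel-verified Lean document; each statement's English description precedes it below -/
import Mathlib

section
/- Let (g,[-,-],α) be a regular hom-Lie algebra over R and let s be an integer. Define ad_s : g → End_R(g) by ad_s(x)(y) = [α^s(x), y]. Then (ad_s, α) is a representation of (g,[-,-],α) on g; that is, ad_s(α(x)) ∘ α = α ∘ ad_s(x) and ad_s([x,y]) ∘ α = ad_s(α(x)) ∘ ad_s(y) − ad_s(α(y)) ∘ ad_s(x) for all x,y ∈ g. -/
/-- Integer powers of a multiplicative linear automorphism are multiplicative. -/
theorem LinearEquiv.zpow_map_bilin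
    {R g : Type*} [CommRing R] [AddCommGroup g] [Module R g]
    (br : g →ₗ[R] g →ₗ[R] g) (α : g ≃ₗ[R] g)
    (hmult : ∀ x y : g, α (br x y) = br (α x) (α y)) (s : ℤ) (x y : g) :
    (α ^ s) (br x y) = br ((α ^ s) x) ((α ^ s) y) := by
  induction s generalizing x y with
  | zero => simp
  | succ n ih => simp only [zpow_add_one, LinearEquiv.mul_apply, hmult, ih]
  | pred n ih =>
    have hinv : α⁻¹ (br x y) = br (α⁻¹ x) (α⁻¹ y) := by
      apply α.injective
      simp only [hmult, ← LinearEquiv.mul_apply, mul_inv_cancel, LinearEquiv.coe_one, id_eq]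
    simp only [zpow_sub_one, LinearEquiv.mul_apply, hinv, ih]


/-- For a regular hom-Lie algebra `(g, br, α)` over a commutative ring `R`
and an integer `s`, the pair `(ad_s, α)` with `ad_s x y = br (α^s x) y` is a
representation of `(g, br, α)` on `g`. -/
theorem homLie_adjoint_rep
    {R g : Type*} [CommRing R] [AddCommGroup g] [Module R g]
    (br : g →ₗ[R] g →ₗ[R] g) (α : g ≃ₗ[R] g)
    (hskew : ∀ x y : g, br x y = - br y x)
    (hmult : ∀ x y : g, α (br x y) = br (α x) (α y))
    (hjac : ∀ x y z : g,
      br (α x) (br y z) + br (α y) (br z x) + br (α z) (br x y) = 0)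
    (s : ℤ) :
    (∀ x y : g, br ((α ^ s) (α x)) (α y) = α (br ((α ^ s) x) y)) ∧
    (∀ x y z : g,
      br ((α ^ s) (br x y)) (α z)
        = br ((α ^ s) (α x)) (br ((α ^ s) y) z)
          - br ((α ^ s) (α y)) (br ((α ^ s) x) z)) := by
  have hcomm (x : g) : (α ^ s) (α x) = α ((α ^ s) x) := by
    rw [← LinearEquiv.mul_apply, ← LinearEquiv.mul_apply, (Commute.self_zpow α s).eq]
  refine ⟨fun x y => by rw [hcomm, hmult], fun x y z => ?_⟩
  rw [hcomm, hcomm, LinearEquiv.zpow_map_bilin br α hmult, hskew _ (α z),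
    hskew ((α ^ s) x) z, map_neg, sub_neg_eq_add]
  exact (eq_neg_of_add_eq_zero_left (hjac _ _ z)).symm
end

section
/- Let (g,[-,-],α) be a hom-Lie algebra over R, and consider on the exterior algebra ∧g = ⊕_{n≥0} ∧^n g (with ∧^0 g = R) the maps α_G and [-,-]_G and the boundary operator d defined on decomposable elements by d(x_1∧⋯∧x_n) = Σ_{1≤i<j≤n} (−1)^{i+j} [x_i,x_j] ∧ α_G(x_1∧⋯∧x̂_i∧⋯∧x̂_j∧⋯∧x_n), with d = 0 on R and on g. Then: (1) d ∘ d = 0; (2) d ∘ α_G = α_G ∘ d; and (3) d generates the bracket, i.e. [X,Y]_G = (−1)^{|X|}( d(X∧Y) − d(X)∧α_G(Y) − (−1)^{|X|} α_G(X)∧d(Y) ) for all homogeneous X,Y ∈ ∧g. Hence d is an exact generator of the hom-Gerstenhaber algebra (∧g, ∧, [-,-]_G, α_G). -/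
open ExteriorAlgebra

namespace ExteriorAlgebra

section Filter

variable {β : Type*} {n : ℕ}

lemma map_filter_finRange_ne_zero (f : Fin (n + 1) → β) :
    ((List.finRange (n + 1)).filter (· ≠ 0)).map f = List.ofFn fun i : Fin n => f i.succ := by
  rw [List.finRange_succ, List.filter_cons_of_neg (by simp), List.filter_map, List.map_map,
    List.filter_eq_self.2 (by simp), List.ofFn_eq_map]
  rfl

lemma map_filter_finRange_ne_succ (f : Fin (n + 1) → β) (i : Fin n) :
    ((List.finRange (n + 1)).filter (· ≠ i.succ)).map f =
      f 0 :: ((List.finRange n).filter (· ≠ i)).map fun k => f k.succ := by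
  rw [List.finRange_succ, List.filter_cons_of_pos (by simp [(Fin.succ_ne_zero i).symm]),
    List.filter_map, List.map_cons, List.map_map]
  simp [Function.comp_def]

lemma map_filter_finRange_ne_zero_and_ne_succ (f : Fin (n + 1) → β) (j : Fin n) :
    ((List.finRange (n + 1)).filter (fun k => k ≠ 0 ∧ k ≠ j.succ)).map f =
      ((List.finRange n).filter (· ≠ j)).map fun k => f k.succ := by
  rw [List.finRange_succ, List.filter_cons_of_neg (by simp), List.filter_map, List.map_map]
  simp [Function.comp_def]

lemma map_filter_finRange_ne_succ_and_ne_succ (f : Fin (n + 1) → β) (i j : Fin n) :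
    ((List.finRange (n + 1)).filter (fun k => k ≠ i.succ ∧ k ≠ j.succ)).map f =
      f 0 :: ((List.finRange n).filter (fun k => k ≠ i ∧ k ≠ j)).map fun k => f k.succ := by
  rw [List.finRange_succ, List.filter_cons_of_pos
    (by simp [(Fin.succ_ne_zero i).symm, (Fin.succ_ne_zero j).symm]),
    List.filter_map, List.map_cons, List.map_map]
  simp [Function.comp_def]

end Filter

variable {R g : Type*} [CommRing R] [AddCommGroup g] [Module R g]

lemma ι_mul_ι_eq_neg (x y : g) : ι R x * ι R y = -(ι R y * ι R x) :=
  eq_neg_of_add_eq_zero_left (ι_add_mul_swap x y)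

lemma ι_mul_ι_mul_eq_neg (x y : g) (z : ExteriorAlgebra R g) :
    ι R x * (ι R y * z) = -(ι R y * (ι R x * z)) := by
  rw [← mul_assoc, ι_mul_ι_eq_neg, neg_mul, mul_assoc]

lemma ι_mul_prod_ofFn (a : g) (n : ℕ) (x : Fin n → g) (z : ExteriorAlgebra R g) :
    ι R a * ((List.ofFn fun i => ι R (x i)).prod * z) =
      ((-1 : ℤ) ^ n) • ((List.ofFn fun i => ι R (x i)).prod * (ι R a * z)) := by
  induction n with
  | zero => simp
  | succ n ih =>
    rw [List.ofFn_succ, List.prod_cons, mul_assoc, ι_mul_ι_mul_eq_neg, ih, pow_succ,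
      mul_neg_one, neg_smul, mul_smul_comm, mul_assoc]

lemma linearMap_ext_prod_ofFn {M : Type*} [AddCommGroup M] [Module R M]
    {f h : ExteriorAlgebra R g →ₗ[R] M}
    (H : ∀ (n : ℕ) (x : Fin n → g),
      f (List.ofFn fun i => ι R (x i)).prod = h (List.ofFn fun i => ι R (x i)).prod) :
    f = h := by
  refine LinearMap.ext_on (ιMulti_span R g) ?_
  rintro _ ⟨⟨n, x⟩, rfl⟩
  simpa [ιMulti_apply] using H n x

lemma induction_ι_mul {P : ExteriorAlgebra R g → Prop}
    (scalar : ∀ r : R, P (algebraMap R _ r)) (add : ∀ x y, P x → P y → P (x + y))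
    (ι_mul : ∀ (x : g) (z), P z → P (ι R x * z)) (z : ExteriorAlgebra R g) : P z :=
  CliffordAlgebra.left_induction (Q := (0 : QuadraticForm R g)) scalar add
    (fun z x hz => ι_mul x z hz) z

/-- The defining formula of the hom-Gerstenhaber bracket on decomposable elements. -/
def IsHomGerstenhaberBracket (br : g →ₗ[R] g →ₗ[R] g)
    (αG : ExteriorAlgebra R g →ₐ[R] ExteriorAlgebra R g)
    (brG : ExteriorAlgebra R g →ₗ[R] ExteriorAlgebra R g →ₗ[R] ExteriorAlgebra R g) : Prop :=
  ∀ (n m : ℕ) (x : Fin n → g) (y : Fin m → g),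
    brG ((List.ofFn fun i => ι R (x i)).prod) ((List.ofFn fun j => ι R (y j)).prod)
      = ∑ i : Fin n, ∑ j : Fin m, ((-1 : ℤ) ^ ((i : ℕ) + (j : ℕ))) •
          (ι R (br (x i) (y j)) *
            αG ((((List.finRange n).filter (· ≠ i)).map (fun k => ι R (x k))
                  ++ ((List.finRange m).filter (· ≠ j)).map (fun k => ι R (y k))).prod))

/-- The defining formula of the hom-Lie boundary operator on decomposable elements. -/
def IsHomLieBoundary (br : g →ₗ[R] g →ₗ[R] g)
    (αG : ExteriorAlgebra R g →ₐ[R] ExteriorAlgebra R g)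
    (d : ExteriorAlgebra R g →ₗ[R] ExteriorAlgebra R g) : Prop :=
  ∀ (n : ℕ) (x : Fin n → g),
    d ((List.ofFn fun i => ι R (x i)).prod)
      = ∑ i : Fin n, ∑ j : Fin n, (if i < j then
          ((-1 : ℤ) ^ ((i : ℕ) + (j : ℕ))) •
            (ι R (br (x i) (x j)) *
              αG ((((List.finRange n).filter (fun k => k ≠ i ∧ k ≠ j)).map
                    (fun k => ι R (x k))).prod))
        else 0)

variable {br : g →ₗ[R] g →ₗ[R] g} {α : g →ₗ[R] g}
  {brG : ExteriorAlgebra R g →ₗ[R] ExteriorAlgebra R g →ₗ[R] ExteriorAlgebra R g}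
  {d : ExteriorAlgebra R g →ₗ[R] ExteriorAlgebra R g}

namespace IsHomGerstenhaberBracket

variable (hb : IsHomGerstenhaberBracket br (map α) brG)

include hb

lemma ι_prod_ofFn (x : g) {m : ℕ} (y : Fin m → g) :
    brG (ι R x) ((List.ofFn fun j => ι R (y j)).prod) =
      ∑ j : Fin m, ((-1 : ℤ) ^ (j : ℕ)) • (ι R (br x (y j)) *
        map α ((((List.finRange m).filter (· ≠ j)).map (fun k => ι R (y k))).prod)) := by
  have h := hb 1 m (fun _ => x) y
  rw [Fin.sum_univ_succ, map_filter_finRange_ne_zero] at h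
  simpa using h

lemma ι_algebraMap (x : g) (r : R) : brG (ι R x) (algebraMap R _ r) = 0 := by
  have h := hb.ι_prod_ofFn x (m := 0) Fin.elim0
  rw [Algebra.algebraMap_eq_smul_one, map_smul]
  simp at h
  simp [h]

lemma ι_ι_mul (x y : g) (z : ExteriorAlgebra R g) :
    brG (ι R x) (ι R y * z) = ι R (br x y) * map α z + ι R (α y) * brG (ι R x) z := by
  suffices h : brG (ι R x) ∘ₗ LinearMap.mulLeft R (ι R y) =
      LinearMap.mulLeft R (ι R (br x y)) ∘ₗ (map α).toLinearMap +
        LinearMap.mulLeft R (ι R (α y)) ∘ₗ brG (ι R x) from DFunLike.congr_fun h z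
  refine linearMap_ext_prod_ofFn fun m w => ?_
  have h := hb.ι_prod_ofFn x (Fin.cons y w)
  rw [List.ofFn_succ, List.prod_cons, Fin.sum_univ_succ, map_filter_finRange_ne_zero] at h
  simp only [map_filter_finRange_ne_succ, Fin.cons_zero, Fin.cons_succ, List.prod_cons, map_mul,
    map_apply_ι] at h
  simp only [LinearMap.comp_apply, LinearMap.mulLeft_apply, LinearMap.add_apply,
    AlgHom.toLinearMap_apply, h, hb.ι_prod_ofFn x w, Finset.mul_sum, Fin.val_zero, pow_zero,
    one_smul, Fin.val_succ]
  congr 1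
  refine Finset.sum_congr rfl fun j _ => ?_
  rw [ι_mul_ι_mul_eq_neg, pow_succ, mul_smul_comm]
  simp

lemma ι_mul (x : g) (z w : ExteriorAlgebra R g) :
    brG (ι R x) (z * w) = brG (ι R x) z * map α w + map α z * brG (ι R x) w := by
  induction z using induction_ι_mul with
  | scalar r =>
    rw [hb.ι_algebraMap, ← Algebra.smul_def, map_smul, AlgHom.commutes, ← Algebra.smul_def,
      zero_mul, zero_add]
  | add a b ha hb' => simp only [add_mul, map_add, ha, hb']; abel
  | ι_mul y z ih =>
    rw [mul_assoc, hb.ι_ι_mul, hb.ι_ι_mul, ih, map_mul, map_mul, map_apply_ι]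
    noncomm_ring

lemma prod_ofFn_succ {n : ℕ} (x : g) (y : Fin n → g) (z : ExteriorAlgebra R g) :
    brG (ι R x * (List.ofFn fun i => ι R (y i)).prod) z =
      ((-1 : ℤ) ^ n) • (map α (List.ofFn fun i => ι R (y i)).prod * brG (ι R x) z) +
        ι R (α x) * brG (List.ofFn fun i => ι R (y i)).prod z := by
  suffices h : brG (ι R x * (List.ofFn fun i => ι R (y i)).prod) =
      ((-1 : ℤ) ^ n) • (LinearMap.mulLeft R (map α (List.ofFn fun i => ι R (y i)).prod) ∘ₗ
        brG (ι R x)) + LinearMap.mulLeft R (ι R (α x)) ∘ₗ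
          brG (List.ofFn fun i => ι R (y i)).prod from DFunLike.congr_fun h z
  refine linearMap_ext_prod_ofFn fun m w => ?_
  have h := hb (n + 1) m (Fin.cons x y) w
  rw [List.ofFn_succ, List.prod_cons, Fin.sum_univ_succ, map_filter_finRange_ne_zero] at h
  simp only [map_filter_finRange_ne_succ, Fin.cons_zero, Fin.cons_succ, List.prod_cons, map_mul,
    map_apply_ι, List.cons_append, List.prod_append] at h
  simp only [LinearMap.comp_apply, LinearMap.mulLeft_apply, LinearMap.add_apply,
    LinearMap.smul_apply, h, hb.ι_prod_ofFn x w, hb n m y w, Finset.mul_sum, Fin.val_zero,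
    zero_add, Fin.val_succ, Finset.smul_sum, List.prod_append, map_mul]
  congr 1
  · refine Finset.sum_congr rfl fun j _ => ?_
    have key (a : g) (v : ExteriorAlgebra R g) := ι_mul_prod_ofFn a n (fun i => α (y i)) v
    have hα : map α (List.ofFn fun i => ι R (y i)).prod =
        (List.ofFn fun i => ι R (α (y i))).prod := by
      simp [map_list_prod, List.map_ofFn, Function.comp_def]
    rw [hα, key, mul_smul_comm, smul_comm]
  · refine Finset.sum_congr rfl fun i _ => Finset.sum_congr rfl fun j _ => ?_
    rw [ι_mul_ι_mul_eq_neg, add_right_comm, pow_succ, mul_smul_comm]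
    simp

lemma ι_map (hmult : ∀ x y : g, α (br x y) = br (α x) (α y)) (x : g)
    (z : ExteriorAlgebra R g) :
    brG (ι R (α x)) (map α z) = map α (brG (ι R x) z) := by
  induction z using induction_ι_mul with
  | scalar r => rw [AlgHom.commutes, hb.ι_algebraMap, hb.ι_algebraMap, map_zero]
  | add a b ha hb' => simp only [map_add, ha, hb']
  | ι_mul y z ih => simp only [map_mul, map_add, map_apply_ι, hb.ι_ι_mul, ih, hmult]

lemma ι_jacobi (hskew : ∀ x y : g, br x y = -br y x)
    (hmult : ∀ x y : g, α (br x y) = br (α x) (α y))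
    (hjac : ∀ x y z : g,
      br (α x) (br y z) + br (α y) (br z x) + br (α z) (br x y) = 0)
    (x y : g) (z : ExteriorAlgebra R g) :
    brG (ι R (α x)) (brG (ι R y) z) =
      brG (ι R (br x y)) (map α z) + brG (ι R (α y)) (brG (ι R x) z) := by
  induction z using induction_ι_mul with
  | scalar r => simp only [AlgHom.commutes, hb.ι_algebraMap, map_zero, add_zero]
  | add a b ha hb' => simp only [map_add, ha, hb']; abel
  | ι_mul w z ih =>
    have hj : br (α x) (br y w) = br (br x y) (α w) + br (α y) (br x w) := by
      have h := hjac x y w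
      rw [hskew w x, hskew (α w), map_neg] at h
      rw [← sub_eq_zero, ← h]
      abel
    simp only [map_mul, map_add, map_apply_ι, hb.ι_ι_mul, ih, hj, hb.ι_map hmult, hmult, mul_add,
      add_mul]
    abel

end IsHomGerstenhaberBracket

namespace IsHomLieBoundary

variable (hd : IsHomLieBoundary br (map α) d)
  (hb : IsHomGerstenhaberBracket br (map α) brG)

include hd

lemma algebraMap_eq_zero (r : R) : d (algebraMap R _ r) = 0 := by
  have h := hd 0 Fin.elim0
  rw [Algebra.algebraMap_eq_smul_one, map_smul]
  simp at h
  simp [h]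

include hb

lemma ι_mul (x : g) (z : ExteriorAlgebra R g) :
    d (ι R x * z) = -brG (ι R x) z - ι R (α x) * d z := by
  suffices h : d ∘ₗ LinearMap.mulLeft R (ι R x) =
      -brG (ι R x) - LinearMap.mulLeft R (ι R (α x)) ∘ₗ d from DFunLike.congr_fun h z
  refine linearMap_ext_prod_ofFn fun m w => ?_
  have h := hd (m + 1) (Fin.cons x w)
  rw [List.ofFn_succ, List.prod_cons, Fin.sum_univ_succ] at h
  simp only [Fin.sum_univ_succ (n := m)] at h
  simp only [map_filter_finRange_ne_zero_and_ne_succ, map_filter_finRange_ne_succ_and_ne_succ,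
    Fin.cons_zero, Fin.cons_succ, List.prod_cons, map_mul, map_apply_ι, lt_irrefl, if_false,
    Fin.not_lt_zero, Fin.succ_pos, if_true, Fin.succ_lt_succ_iff, zero_add] at h
  simp only [LinearMap.comp_apply, LinearMap.mulLeft_apply, LinearMap.sub_apply,
    LinearMap.neg_apply, h, hb.ι_prod_ofFn x w, hd m w, Finset.mul_sum, Fin.val_zero,
    zero_add, Fin.val_succ]
  rw [sub_eq_add_neg, ← Finset.sum_neg_distrib, ← Finset.sum_neg_distrib]
  simp only [← Finset.sum_neg_distrib]
  congr 1
  · refine Finset.sum_congr rfl fun j _ => ?_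
    rw [pow_succ]
    simp
  · refine Finset.sum_congr rfl fun i _ => Finset.sum_congr rfl fun j _ => ?_
    split_ifs
    · rw [ι_mul_ι_mul_eq_neg, mul_smul_comm, ← add_assoc, add_right_comm (i : ℕ) 1, pow_add,
        pow_add]
      simp
    · simp

lemma map_comm (hmult : ∀ x y : g, α (br x y) = br (α x) (α y)) (z : ExteriorAlgebra R g) :
    d (map α z) = map α (d z) := by
  induction z using induction_ι_mul with
  | scalar r => rw [AlgHom.commutes, hd.algebraMap_eq_zero, map_zero]
  | add a b ha hb' => simp only [map_add, ha, hb']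
  | ι_mul y z ih =>
    simp only [map_mul, map_sub, map_neg, map_apply_ι, hd.ι_mul hb, ih, hb.ι_map hmult]

lemma ι_bracket (hskew : ∀ x y : g, br x y = -br y x)
    (hmult : ∀ x y : g, α (br x y) = br (α x) (α y))
    (hjac : ∀ x y z : g,
      br (α x) (br y z) + br (α y) (br z x) + br (α z) (br x y) = 0)
    (x : g) (z : ExteriorAlgebra R g) :
    d (brG (ι R x) z) = brG (ι R (α x)) (d z) := by
  induction z using induction_ι_mul with
  | scalar r => simp only [hd.algebraMap_eq_zero, hb.ι_algebraMap, map_zero]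
  | add a b ha hb' => simp only [map_add, ha, hb']
  | ι_mul y z ih =>
    simp only [map_add, map_sub, map_neg, hb.ι_ι_mul, hd.ι_mul hb, ih,
      hb.ι_jacobi hskew hmult hjac x y z, hd.map_comm hb hmult, hmult]
    abel

lemma comp_self (hskew : ∀ x y : g, br x y = -br y x)
    (hmult : ∀ x y : g, α (br x y) = br (α x) (α y))
    (hjac : ∀ x y z : g,
      br (α x) (br y z) + br (α y) (br z x) + br (α z) (br x y) = 0)
    (z : ExteriorAlgebra R g) : d (d z) = 0 := by
  induction z using induction_ι_mul with
  | scalar r => rw [hd.algebraMap_eq_zero, map_zero]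
  | add a b ha hb' => rw [map_add, map_add, ha, hb', add_zero]
  | ι_mul y z ih =>
    simp only [map_sub, map_neg, hd.ι_mul hb, hd.ι_bracket hb hskew hmult hjac, ih, mul_zero]
    abel

lemma bracket_prod_ofFn (n : ℕ) (x : Fin n → g) (z : ExteriorAlgebra R g) :
    brG (List.ofFn fun i => ι R (x i)).prod z = ((-1 : ℤ) ^ n) •
      (d ((List.ofFn fun i => ι R (x i)).prod * z) -
        d (List.ofFn fun i => ι R (x i)).prod * map α z -
        ((-1 : ℤ) ^ n) • (map α (List.ofFn fun i => ι R (x i)).prod * d z)) := by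
  have hsq (k : ℕ) : ((-1 : ℤ) ^ k) * (-1) ^ k = 1 := by rw [← mul_pow]; simp
  induction n with
  | zero =>
    have h1 : d 1 = 0 := by simpa using hd.algebraMap_eq_zero 1
    have h2 : brG 1 = 0 := linearMap_ext_prod_ofFn fun m y => by simpa using hb 0 m Fin.elim0 y
    simp [h1, h2]
  | succ n ih =>
    rw [List.ofFn_succ, List.prod_cons, hb.prod_ofFn_succ, ih, mul_assoc, hd.ι_mul hb,
      hd.ι_mul hb, hb.ι_mul, map_mul (map α), map_apply_ι]
    simp only [smul_sub, smul_smul, hsq, one_smul, mul_sub, sub_mul, neg_mul, mul_smul_comm,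
      pow_succ, mul_neg_one, neg_smul, smul_neg, mul_assoc, smul_add, neg_add]
    abel

lemma bracket_eq {p : ℕ} {X : ExteriorAlgebra R g} (hX : X ∈ ⋀[R]^p g)
    (Y : ExteriorAlgebra R g) :
    brG X Y = ((-1 : ℤ) ^ p) •
      (d (X * Y) - d X * map α Y - ((-1 : ℤ) ^ p) • (map α X * d Y)) := by
  rw [← ιMulti_span_fixedDegree] at hX
  induction hX using Submodule.span_induction with
  | mem X hX =>
    obtain ⟨x, rfl⟩ := hX
    exact hd.bracket_prod_ofFn hb p x Y
  | zero => simp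
  | add a b _ _ ha hb' =>
    simp only [map_add, LinearMap.add_apply, ha, hb', add_mul, smul_sub, smul_add]
    abel
  | smul r a _ ha =>
    simp only [map_smul, LinearMap.smul_apply, ha, smul_mul_assoc, smul_sub, smul_comm r]

end IsHomLieBoundary

end ExteriorAlgebra

/-- For a hom-Lie algebra `(g, br, α)` over `R`, the boundary operator `d`
of hom-Lie algebra homology with trivial coefficients, defined on decomposables of the
exterior algebra `∧g` by
`d(x₁∧⋯∧xₙ) = Σ_{i<j} (−1)^{i+j} [xᵢ,xⱼ] ∧ α_G(x₁∧⋯∧x̂ᵢ∧⋯∧x̂ⱼ∧⋯∧xₙ)`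
(and `d = 0` on `R` and on `g`), satisfies `d² = 0`, `d ∘ α_G = α_G ∘ d`, and generates
the hom-Gerstenhaber bracket `[-,-]_G`; hence `d` is an exact generator of
`(∧g, ∧, [-,-]_G, α_G)`. -/
theorem homLie_boundary_is_exact_generator
    {R g : Type*} [CommRing R] [AddCommGroup g] [Module R g]
    (br : g →ₗ[R] g →ₗ[R] g) (α : g →ₗ[R] g)
    (hskew : ∀ x y : g, br x y = - br y x)
    (hmult : ∀ x y : g, α (br x y) = br (α x) (α y))
    (hjac : ∀ x y z : g,
      br (α x) (br y z) + br (α y) (br z x) + br (α z) (br x y) = 0)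
    -- `α_G` is the canonical extension of `α` to the exterior algebra
    (αG : ExteriorAlgebra R g →ₐ[R] ExteriorAlgebra R g)
    (hαG : αG = ExteriorAlgebra.map α)
    -- the hom-Gerstenhaber bracket `[-,-]_G` on `∧g`, defined on decomposables
    (brG : ExteriorAlgebra R g →ₗ[R] ExteriorAlgebra R g →ₗ[R] ExteriorAlgebra R g)
    (hbrG_scalar_left : ∀ (r : R) (z : ExteriorAlgebra R g),
      brG (algebraMap R (ExteriorAlgebra R g) r) z = 0)
    (hbrG_scalar_right : ∀ (r : R) (z : ExteriorAlgebra R g),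
      brG z (algebraMap R (ExteriorAlgebra R g) r) = 0)
    (hbrG : ∀ (n m : ℕ) (x : Fin n → g) (y : Fin m → g),
      brG ((List.ofFn fun i => ι R (x i)).prod) ((List.ofFn fun j => ι R (y j)).prod)
        = ∑ i : Fin n, ∑ j : Fin m, ((-1 : ℤ) ^ ((i : ℕ) + (j : ℕ))) •
            (ι R (br (x i) (y j)) *
              αG ((((List.finRange n).filter (· ≠ i)).map (fun k => ι R (x k))
                    ++ ((List.finRange m).filter (· ≠ j)).map (fun k => ι R (y k))).prod)))
    -- the boundary operator `d`, defined on decomposables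
    (d : ExteriorAlgebra R g →ₗ[R] ExteriorAlgebra R g)
    (hd_scalar : ∀ r : R, d (algebraMap R (ExteriorAlgebra R g) r) = 0)
    (hd_deg1 : ∀ x : g, d (ι R x) = 0)
    (hd : ∀ (n : ℕ) (x : Fin n → g),
      d ((List.ofFn fun i => ι R (x i)).prod)
        = ∑ i : Fin n, ∑ j : Fin n, (if i < j then
            ((-1 : ℤ) ^ ((i : ℕ) + (j : ℕ))) •
              (ι R (br (x i) (x j)) *
                αG ((((List.finRange n).filter (fun k => k ≠ i ∧ k ≠ j)).map
                      (fun k => ι R (x k))).prod))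
          else 0)) :
    (∀ z : ExteriorAlgebra R g, d (d z) = 0) ∧
    (∀ z : ExteriorAlgebra R g, d (αG z) = αG (d z)) ∧
    (∀ (p q : ℕ) (X Y : ExteriorAlgebra R g), X ∈ ⋀[R]^p g → Y ∈ ⋀[R]^q g →
      brG X Y = ((-1 : ℤ) ^ p) •
        (d (X * Y) - d X * αG Y - ((-1 : ℤ) ^ p) • (αG X * d Y))) := by
  subst hαG
  have hb : IsHomGerstenhaberBracket br (map α) brG := hbrG
  have hd' : IsHomLieBoundary br (map α) d := hd
  exact ⟨hd'.comp_self hb hskew hmult hjac, hd'.map_comm hb hmult,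
    fun _ _ _ Y hX _ => hd'.bracket_eq hb hX Y⟩
end

section
/- Let (G,∧,[-,-]) be a Gerstenhaber algebra over R, let ∂ be a generator of its bracket, and let α be a degree-0 endomorphism of G preserving both ∧ and [-,-] and satisfying ∂ ∘ α = α ∘ ∂. Set ∂_α := α ∘ ∂ and [X,Y]_α := α([X,Y]). Then ∂_α ∘ α = α ∘ ∂_α, and ∂_α generates the twisted bracket: [X,Y]_α = (−1)^{|X|}( ∂_α(X∧Y) − ∂_α(X)∧α(Y) − (−1)^{|X|} α(X)∧∂_α(Y) ) for all homogeneous X,Y ∈ G. Moreover, if ∂² = 0 then ∂_α² = 0. -/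
/-- If `∂` generates the bracket of a Gerstenhaber algebra `(G,∧,[-,-])`
and `α` is a degree-0 endomorphism preserving the product and the bracket with
`∂ ∘ α = α ∘ ∂`, then `∂_α := α ∘ ∂` commutes with `α` and generates the twisted
bracket `[X,Y]_α := α [X,Y]`; moreover `∂² = 0` implies `∂_α² = 0`. -/
theorem twisted_generator_of_BV
    {R G : Type*} [CommRing R] [Ring G] [Algebra R G]
    (𝒜 : ℕ → Submodule R G)
    (hinternal : DirectSum.IsInternal 𝒜)
    -- graded commutative associative product (the product of `G`)
    (hmul_deg : ∀ (i j : ℕ) (X Y : G), X ∈ 𝒜 i → Y ∈ 𝒜 j → X * Y ∈ 𝒜 (i + j))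
    (hmul_comm : ∀ (i j : ℕ) (X Y : G), X ∈ 𝒜 i → Y ∈ 𝒜 j →
      X * Y = ((-1 : ℤ) ^ (i * j)) • (Y * X))
    -- the Gerstenhaber bracket
    (br : G →ₗ[R] G →ₗ[R] G)
    (hbr_deg : ∀ (i j : ℕ) (X Y : G), X ∈ 𝒜 i → Y ∈ 𝒜 j → br X Y ∈ 𝒜 (i + j - 1))
    (hbr_skew : ∀ (i j : ℕ) (X Y : G), X ∈ 𝒜 i → Y ∈ 𝒜 j →
      br X Y = -((Int.negOnePow (((i : ℤ) - 1) * ((j : ℤ) - 1)) : ℤ) • br Y X))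
    (hbr_jacobi : ∀ (i j k : ℕ) (X Y Z : G), X ∈ 𝒜 i → Y ∈ 𝒜 j → Z ∈ 𝒜 k →
      (Int.negOnePow (((i : ℤ) - 1) * ((k : ℤ) - 1)) : ℤ) • br X (br Y Z)
      + (Int.negOnePow (((j : ℤ) - 1) * ((i : ℤ) - 1)) : ℤ) • br Y (br Z X)
      + (Int.negOnePow (((k : ℤ) - 1) * ((j : ℤ) - 1)) : ℤ) • br Z (br X Y) = 0)
    (hbr_leibniz : ∀ (i j k : ℕ) (X Y Z : G), X ∈ 𝒜 i → Y ∈ 𝒜 j → Z ∈ 𝒜 k →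
      br X (Y * Z) = br X Y * Z
        + (Int.negOnePow (((i : ℤ) - 1) * (j : ℤ)) : ℤ) • (Y * br X Z))
    -- `∂` is a generator of the bracket, of degree `-1`
    (D : G →ₗ[R] G)
    (hD_deg : ∀ (i : ℕ) (X : G), X ∈ 𝒜 (i + 1) → D X ∈ 𝒜 i)
    (hD_deg0 : ∀ X : G, X ∈ 𝒜 0 → D X = 0)
    (hD_gen : ∀ (i j : ℕ) (X Y : G), X ∈ 𝒜 i → Y ∈ 𝒜 j →
      br X Y = ((-1 : ℤ) ^ i) • (D (X * Y) - D X * Y - ((-1 : ℤ) ^ i) • (X * D Y)))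
    -- `α`: degree-0 endomorphism preserving `∧` and `[-,-]`, commuting with `∂`
    (α : G →ₐ[R] G)
    (hα_deg : ∀ (i : ℕ) (X : G), X ∈ 𝒜 i → α X ∈ 𝒜 i)
    (hα_br : ∀ X Y : G, α (br X Y) = br (α X) (α Y))
    (hDα : ∀ X : G, D (α X) = α (D X)) :
    -- `∂_α := α ∘ ∂` commutes with `α`
    (∀ X : G, α (D (α X)) = α (α (D X))) ∧
    -- `∂_α` generates the twisted bracket `[X,Y]_α = α [X,Y]`
    (∀ (i j : ℕ) (X Y : G), X ∈ 𝒜 i → Y ∈ 𝒜 j →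
      α (br X Y) = ((-1 : ℤ) ^ i) •
        (α (D (X * Y)) - α (D X) * α Y - ((-1 : ℤ) ^ i) • (α X * α (D Y)))) ∧
    -- if `∂² = 0` then `∂_α² = 0`
    ((∀ X : G, D (D X) = 0) → ∀ X : G, α (D (α (D X))) = 0) := by
  refine ⟨fun X => by rw [hDα], fun i j X Y hX hY => ?_, fun hD X => by simp [hDα, hD]⟩
  rw [hD_gen i j X Y hX hY]
  simp only [map_zsmul, map_sub, map_mul]
end

section
/- Let (G,∧,[-,-]) be a Gerstenhaber algebra over R and let α be a degree-0 endomorphism of G preserving both ∧ and [-,-]. Then (G, ∧, [-,-]_α, α) with [X,Y]_α := α([X,Y]) is a hom-Gerstenhaber algebra; that is, [X,Y]_α = −(−1)^{(|X|−1)(|Y|−1)}[Y,X]_α, α([X,Y]_α) = [α(X),α(Y)]_α, the graded hom-Jacobi identity (−1)^{(|X|−1)(|Z|−1)}[α(X),[Y,Z]_α]_α + (−1)^{(|Y|−1)(|X|−1)}[α(Y),[Z,X]_α]_α + (−1)^{(|Z|−1)(|Y|−1)}[α(Z),[X,Y]_α]_α = 0 holds, and the hom-Leibniz rule [X, Y∧Z]_α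 = [X,Y]_α∧α(Z) + (−1)^{(|X|−1)|Y|} α(Y)∧[X,Z]_α holds for all homogeneous X,Y,Z ∈ G. -/
/-- If `(G,∧,[-,-])` is a Gerstenhaber algebra and `α` is a degree-0
endomorphism preserving `∧` and `[-,-]`, then `(G, ∧, [-,-]_α, α)` with
`[X,Y]_α := α [X,Y]` is a hom-Gerstenhaber algebra. -/
theorem homGerstenhaber_of_Gerstenhaber_twist
    {R G : Type*} [CommRing R] [Ring G] [Algebra R G]
    (𝒜 : ℕ → Submodule R G)
    (hinternal : DirectSum.IsInternal 𝒜)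
    (hmul_deg : ∀ (i j : ℕ) (X Y : G), X ∈ 𝒜 i → Y ∈ 𝒜 j → X * Y ∈ 𝒜 (i + j))
    (hmul_comm : ∀ (i j : ℕ) (X Y : G), X ∈ 𝒜 i → Y ∈ 𝒜 j →
      X * Y = ((-1 : ℤ) ^ (i * j)) • (Y * X))
    (br : G →ₗ[R] G →ₗ[R] G)
    (hbr_deg : ∀ (i j : ℕ) (X Y : G), X ∈ 𝒜 i → Y ∈ 𝒜 j → br X Y ∈ 𝒜 (i + j - 1))
    (hbr_skew : ∀ (i j : ℕ) (X Y : G), X ∈ 𝒜 i → Y ∈ 𝒜 j →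
      br X Y = -((Int.negOnePow (((i : ℤ) - 1) * ((j : ℤ) - 1)) : ℤ) • br Y X))
    (hbr_jacobi : ∀ (i j k : ℕ) (X Y Z : G), X ∈ 𝒜 i → Y ∈ 𝒜 j → Z ∈ 𝒜 k →
      (Int.negOnePow (((i : ℤ) - 1) * ((k : ℤ) - 1)) : ℤ) • br X (br Y Z)
      + (Int.negOnePow (((j : ℤ) - 1) * ((i : ℤ) - 1)) : ℤ) • br Y (br Z X)
      + (Int.negOnePow (((k : ℤ) - 1) * ((j : ℤ) - 1)) : ℤ) • br Z (br X Y) = 0)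
    (hbr_leibniz : ∀ (i j k : ℕ) (X Y Z : G), X ∈ 𝒜 i → Y ∈ 𝒜 j → Z ∈ 𝒜 k →
      br X (Y * Z) = br X Y * Z
        + (Int.negOnePow (((i : ℤ) - 1) * (j : ℤ)) : ℤ) • (Y * br X Z))
    -- `α`: degree-0 endomorphism preserving `∧` and `[-,-]`
    (α : G →ₐ[R] G)
    (hα_deg : ∀ (i : ℕ) (X : G), X ∈ 𝒜 i → α X ∈ 𝒜 i)
    (hα_br : ∀ X Y : G, α (br X Y) = br (α X) (α Y)) :
    -- graded skew-symmetry of `[-,-]_α`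
    (∀ (i j : ℕ) (X Y : G), X ∈ 𝒜 i → Y ∈ 𝒜 j →
      α (br X Y) = -((Int.negOnePow (((i : ℤ) - 1) * ((j : ℤ) - 1)) : ℤ) • α (br Y X))) ∧
    -- `α`-multiplicativity of `[-,-]_α`
    (∀ X Y : G, α (α (br X Y)) = α (br (α X) (α Y))) ∧
    -- graded hom-Jacobi identity for `[-,-]_α`
    (∀ (i j k : ℕ) (X Y Z : G), X ∈ 𝒜 i → Y ∈ 𝒜 j → Z ∈ 𝒜 k →
      (Int.negOnePow (((i : ℤ) - 1) * ((k : ℤ) - 1)) : ℤ) • α (br (α X) (α (br Y Z)))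
      + (Int.negOnePow (((j : ℤ) - 1) * ((i : ℤ) - 1)) : ℤ) • α (br (α Y) (α (br Z X)))
      + (Int.negOnePow (((k : ℤ) - 1) * ((j : ℤ) - 1)) : ℤ) • α (br (α Z) (α (br X Y)))
        = 0) ∧
    -- hom-Leibniz rule for `[-,-]_α`
    (∀ (i j k : ℕ) (X Y Z : G), X ∈ 𝒜 i → Y ∈ 𝒜 j → Z ∈ 𝒜 k →
      α (br X (Y * Z)) = α (br X Y) * α Z
        + (Int.negOnePow (((i : ℤ) - 1) * (j : ℤ)) : ℤ) • (α Y * α (br X Z))) := by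
  refine ⟨fun i j X Y hX hY => ?_, fun X Y => congrArg α (hα_br X Y),
    fun i j k X Y Z hX hY hZ => ?_, fun i j k X Y Z hX hY hZ => ?_⟩
  · rw [hbr_skew i j X Y hX hY, map_neg, map_zsmul]
  · simpa only [map_add, map_zsmul, map_zero, hα_br] using
      congrArg (fun W => α (α W)) (hbr_jacobi i j k X Y Z hX hY hZ)
  · rw [hbr_leibniz i j k X Y Z hX hY hZ, map_add, map_zsmul, map_mul, map_mul]
end

section
/- Let (L,α) be a regular hom-Lie-Rinehart algebra over (A,φ). With the wedge product, the map Φ and the contraction i_x on Alt_A(L,A) as in the context, for every x ∈ L, η_1 ∈ Alt_A^m(L,A) and η_2 ∈ Alt_A^k(L,A) one has i_x(η_1 ∧ η_2) = i_x(η_1) ∧ Φ(η_2) + (−1)^m Φ(η_1) ∧ i_x(η_2). -/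
/-! Degree-indexed "raw cochains" `∀ p, (Fin p → L) → A`, used to encode the graded
module `Alt_A(L,A) = ⊕_p Alt_A^p(L,A)` together with its shuffle wedge product, the
twist map `Φ` and the contractions `i_x`. A raw cochain of degree `p` is supported in
arity `p`; degree `-1` objects are identically zero. -/

/-- Raw cochains on `L` with values in `A`. -/
abbrev RawCochain (L A : Type*) := ∀ p : ℕ, (Fin p → L) → A

/-- The `(p,q)`-shuffles in `S_{p+q}`: permutations `σ` with
`σ(1) < ⋯ < σ(p)` and `σ(p+1) < ⋯ < σ(p+q)`. -/
def shuffles (p q : ℕ) : Finset (Equiv.Perm (Fin (p + q))) :=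
  Finset.univ.filter fun σ =>
    (∀ a b : Fin p, a < b → σ (Fin.castAdd q a) < σ (Fin.castAdd q b)) ∧
    (∀ a b : Fin q, a < b → σ (Fin.natAdd p a) < σ (Fin.natAdd p b))

/-- A degree-`m` alternating map, viewed as a raw cochain supported in arity `m`. -/
def ofAlt {A L : Type*} [CommRing A] [AddCommGroup L] [Module A L] (m : ℕ)
    (ξ : AlternatingMap A L A (Fin m)) : RawCochain L A :=
  fun s v => if h : s = m then ξ (fun t => v (Fin.cast h.symm t)) else 0

/-- The shuffle wedge product of raw cochains of degrees `p` and `q`: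
`(ξ∧η)(x₁,…,x_{p+q}) = Σ_{σ ∈ S(p,q)} sgn(σ) ξ(x_{σ(1)},…,x_{σ(p)})·η(x_{σ(p+1)},…)`. -/
def wedgeF {A L : Type*} [CommRing A] (p q : ℕ) (ξ η : RawCochain L A) :
    RawCochain L A :=
  fun s v =>
    if h : s = p + q then
      ∑ σ ∈ shuffles p q,
        ((Equiv.Perm.sign σ : ℤˣ) : ℤ) •
          (ξ p (fun a => v (Fin.cast h.symm (σ (Fin.castAdd q a)))) *
            η q (fun b => v (Fin.cast h.symm (σ (Fin.natAdd p b)))))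
    else 0

/-- The twist map `Φ(ξ)(x₁,…,x_p) = φ(ξ(α⁻¹x₁,…,α⁻¹x_p))`. -/
def PhiF {R A L : Type*} [CommRing R] [CommRing A] [Algebra R A]
    [AddCommGroup L] [Module R L] (φ : A ≃ₐ[R] A) (α : L ≃ₗ[R] L)
    (ξ : RawCochain L A) : RawCochain L A :=
  fun p v => φ (ξ p fun t => α.symm (v t))

/-- The contraction `i_x` of a raw cochain of degree `m`:
`(i_x η)(x₁,…,x_{m-1}) = Φ(η)(α(x), x₁,…,x_{m-1})`; it has degree `m − 1`
(and is zero when `m = 0`). -/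
def ixF {R A L : Type*} [CommRing R] [CommRing A] [Algebra R A]
    [AddCommGroup L] [Module R L] (φ : A ≃ₐ[R] A) (α : L ≃ₗ[R] L)
    (x : L) (m : ℕ) (ξ : RawCochain L A) : RawCochain L A :=
  fun s v =>
    if h : s + 1 = m then
      φ (ξ m fun t =>
        (Fin.cons x (fun u : Fin s => α.symm (v u)) : Fin (s + 1) → L)
          (Fin.cast h.symm t))
    else 0

/-- The permutation of `Fin (n + 1)` sending `i` to `0` and acting as `τ`, up to order-preserving
relabelling, from the complement of `i` to the complement of `0`. -/
def permInsert {n : ℕ} (i : Fin (n + 1)) (τ : Equiv.Perm (Fin n)) : Equiv.Perm (Fin (n + 1)) :=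
  Equiv.Perm.decomposeFin.symm (0, τ) * Fin.cycleRange i

theorem permInsert_self {n : ℕ} (i : Fin (n + 1)) (τ : Equiv.Perm (Fin n)) :
    permInsert i τ i = 0 := by
  simp [permInsert]

theorem permInsert_succAbove {n : ℕ} (i : Fin (n + 1)) (τ : Equiv.Perm (Fin n)) (j : Fin n) :
    permInsert i τ (i.succAbove j) = (τ j).succ := by
  simp [permInsert]

theorem sign_permInsert {n : ℕ} (i : Fin (n + 1)) (τ : Equiv.Perm (Fin n)) :
    Equiv.Perm.sign (permInsert i τ) = (-1) ^ (i : ℕ) * Equiv.Perm.sign τ := by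
  simp [permInsert, mul_comm]

theorem permInsert_injective {n : ℕ} (i : Fin (n + 1)) : Function.Injective (permInsert i) := by
  intro τ τ' h
  simpa using Equiv.Perm.decomposeFin.symm.injective (mul_right_cancel h)

theorem exists_permInsert_eq {n : ℕ} {i : Fin (n + 1)} {σ : Equiv.Perm (Fin (n + 1))}
    (h : σ i = 0) : ∃ τ, permInsert i τ = σ := by
  obtain ⟨⟨p, τ⟩, hp⟩ := Equiv.Perm.decomposeFin.symm.surjective (σ * (Fin.cycleRange i)⁻¹)
  have hp0 : p = 0 := by
    have h0 := congrArg (fun e : Equiv.Perm (Fin (n + 1)) => e (Fin.cycleRange i i)) hp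
    simpa [h] using h0
  subst hp0
  exact ⟨τ, by rw [permInsert, hp, inv_mul_cancel_right]⟩

/-- Sum over the permutations in `S` sending `i` to `0`, reindexed by `permInsert i`. -/
theorem sum_filter_apply_eq_zero {n : ℕ} {M : Type*} [AddCommMonoid M] (i : Fin (n + 1))
    (S : Finset (Equiv.Perm (Fin (n + 1)))) (T : Finset (Equiv.Perm (Fin n)))
    (hST : ∀ τ, permInsert i τ ∈ S ↔ τ ∈ T) (F : Equiv.Perm (Fin (n + 1)) → M) :
    ∑ σ ∈ S with σ i = 0, F σ = ∑ τ ∈ T, F (permInsert i τ) := by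
  symm
  refine Finset.sum_nbij (permInsert i) ?_ (permInsert_injective i).injOn ?_ fun _ _ => rfl
  · intro τ hτ
    exact Finset.mem_filter.2 ⟨(hST τ).2 hτ, permInsert_self i τ⟩
  · intro σ hσ
    obtain ⟨hS, h0⟩ := Finset.mem_filter.1 hσ
    obtain ⟨τ, rfl⟩ := exists_permInsert_eq h0
    exact ⟨τ, (hST τ).1 hS, rfl⟩

/-- The permutations of `Fin n` that are increasing along both `l` and `r`. -/
def shufflesAlong {n p q : ℕ} (l : Fin p → Fin n) (r : Fin q → Fin n) :
    Finset (Equiv.Perm (Fin n)) :=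
  Finset.univ.filter fun σ => (∀ a b, a < b → σ (l a) < σ (l b)) ∧ ∀ a b, a < b → σ (r a) < σ (r b)

theorem mem_shufflesAlong {n p q : ℕ} {l : Fin p → Fin n} {r : Fin q → Fin n}
    {σ : Equiv.Perm (Fin n)} : σ ∈ shufflesAlong l r ↔
      (∀ a b, a < b → σ (l a) < σ (l b)) ∧ ∀ a b, a < b → σ (r a) < σ (r b) := by
  simp [shufflesAlong]

theorem shufflesAlong_comm {n p q : ℕ} (l : Fin p → Fin n) (r : Fin q → Fin n) :
    shufflesAlong l r = shufflesAlong r l := by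
  ext σ
  rw [mem_shufflesAlong, mem_shufflesAlong, and_comm]

theorem permInsert_mem_shufflesAlong {n p q : ℕ} {l : Fin (p + 1) → Fin (n + 1)}
    {r : Fin q → Fin (n + 1)} {l' : Fin p → Fin n} {r' : Fin q → Fin n}
    (hl : ∀ a, l a.succ = (l 0).succAbove (l' a)) (hr : ∀ b, r b = (l 0).succAbove (r' b))
    (τ : Equiv.Perm (Fin n)) :
    permInsert (l 0) τ ∈ shufflesAlong l r ↔ τ ∈ shufflesAlong l' r' := by
  simp [mem_shufflesAlong, Fin.forall_fin_succ (n := p), hl, hr, permInsert_self,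
    permInsert_succAbove]

theorem exists_apply_eq_zero_iff {n p q : ℕ} {l : Fin (p + 1) → Fin (n + 1)}
    {r : Fin q → Fin (n + 1)} {σ : Equiv.Perm (Fin (n + 1))} (hσ : σ ∈ shufflesAlong l r) :
    (∃ a, σ (l a) = 0) ↔ σ (l 0) = 0 := by
  refine ⟨fun ⟨a, ha⟩ => ?_, fun h => ⟨0, h⟩⟩
  rcases Fin.eq_zero_or_eq_succ a with rfl | ⟨a, rfl⟩
  · exact ha
  · have h := (mem_shufflesAlong.1 hσ).1 0 a.succ a.succ_pos
    rw [ha] at h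
    exact absurd h (Fin.not_lt_zero _)

/-- The part of a shuffle sum over the shuffles that take the value `0` along `l`. -/
theorem sum_shufflesAlong_exists_eq_zero {A L : Type*} [CommRing A] {n p q : ℕ}
    {l : Fin (p + 1) → Fin (n + 1)} {r : Fin q → Fin (n + 1)} {l' : Fin p → Fin n}
    {r' : Fin q → Fin n} (hl : ∀ a, l a.succ = (l 0).succAbove (l' a))
    (hr : ∀ b, r b = (l 0).succAbove (r' b)) (f : (Fin (p + 1) → L) → A) (g : (Fin q → L) → A)
    (x : L) (w : Fin n → L) :
    ∑ σ ∈ shufflesAlong l r with ∃ a, σ (l a) = 0, ((Equiv.Perm.sign σ : ℤˣ) : ℤ) •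
        (f (fun a => (Fin.cons x w : Fin (n + 1) → L) (σ (l a))) *
          g fun b => (Fin.cons x w : Fin (n + 1) → L) (σ (r b))) =
      ((-1 : ℤ) ^ (l 0 : ℕ)) • ∑ τ ∈ shufflesAlong l' r', ((Equiv.Perm.sign τ : ℤˣ) : ℤ) •
        (f (Fin.cons x fun a => w (τ (l' a))) * g fun b => w (τ (r' b))) := by
  rw [Finset.filter_congr fun σ hσ => exists_apply_eq_zero_iff hσ,
    sum_filter_apply_eq_zero (l 0) _ _ (permInsert_mem_shufflesAlong hl hr), Finset.smul_sum]
  refine Finset.sum_congr rfl fun τ _ => ?_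
  have h1 : (fun a => (Fin.cons x w : Fin (n + 1) → L) (permInsert (l 0) τ (l a))) =
      (Fin.cons x fun a => w (τ (l' a)) : Fin (p + 1) → L) := by
    funext a
    refine Fin.cases ?_ (fun a => ?_) a
    · simp [permInsert_self]
    · simp [hl, permInsert_succAbove]
  have h2 : (fun b => (Fin.cons x w : Fin (n + 1) → L) (permInsert (l 0) τ (r b))) =
      fun b => w (τ (r' b)) := by
    funext b
    simp [hr, permInsert_succAbove]
  rw [h1, h2, sign_permInsert, smul_smul]
  push_cast
  rfl

theorem ofAlt_self {A L : Type*} [CommRing A] [AddCommGroup L] [Module A L] (m : ℕ)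
    (ξ : AlternatingMap A L A (Fin m)) (v : Fin m → L) : ofAlt m ξ m v = ξ v := by
  simp [ofAlt]

/-- The first `p` indices of `Fin n`, for `n = p + q`. -/
def leftBlock {n p q : ℕ} (h : n = p + q) (a : Fin p) : Fin n := Fin.cast h.symm (Fin.castAdd q a)

/-- The last `q` indices of `Fin n`, for `n = p + q`. -/
def rightBlock {n p q : ℕ} (h : n = p + q) (b : Fin q) : Fin n := Fin.cast h.symm (Fin.natAdd p b)

theorem wedgeF_apply {A L : Type*} [CommRing A] {n p q : ℕ} (h : n = p + q)
    (ξ η : RawCochain L A) (v : Fin n → L) :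
    wedgeF p q ξ η n v = ∑ σ ∈ shufflesAlong (leftBlock h) (rightBlock h),
      ((Equiv.Perm.sign σ : ℤˣ) : ℤ) •
        (ξ p (fun a => v (σ (leftBlock h a))) * η q fun b => v (σ (rightBlock h b))) := by
  subst h
  rw [wedgeF, dif_pos rfl]
  rfl

theorem wedgeF_cast {A L : Type*} [CommRing A] {n n' p q : ℕ} (h : n = n')
    (ξ η : RawCochain L A) (v : Fin n → L) :
    wedgeF p q ξ η n' (fun t => v (Fin.cast h.symm t)) = wedgeF p q ξ η n v := by
  subst h
  rfl

theorem not_exists_leftBlock_iff {n p q : ℕ} (h : n + 1 = p + q) (σ : Equiv.Perm (Fin (n + 1))) :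
    (¬ ∃ a, σ (leftBlock h a) = 0) ↔ ∃ b, σ (rightBlock h b) = 0 := by
  constructor
  · intro hn
    obtain ⟨c, hc⟩ := σ.surjective 0
    obtain ⟨d, rfl⟩ : ∃ d, Fin.cast h.symm d = c := ⟨Fin.cast h c, by simp⟩
    induction d using Fin.addCases with
    | left a => exact absurd ⟨a, hc⟩ hn
    | right b => exact ⟨b, hc⟩
  · rintro ⟨b, hb⟩ ⟨a, ha⟩
    have hab := congrArg Fin.val (σ.injective (ha.trans hb.symm))
    simp only [leftBlock, rightBlock, Fin.val_cast, Fin.val_castAdd, Fin.val_natAdd] at hab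
    have := a.isLt
    omega

/-- The part of the contraction of a wedge product in which the contracted vector is inserted
into the left factor. -/
theorem map_sum_exists_leftBlock {R A L : Type*} [CommRing R] [CommRing A] [Algebra R A]
    [AddCommGroup L] [Module R L] [Module A L] (φ : A ≃ₐ[R] A) (α : L ≃ₗ[R] L) {m k s : ℕ}
    (h : s + 1 = m + k) (η₁ : AlternatingMap A L A (Fin m)) (η₂ : AlternatingMap A L A (Fin k))
    (x : L) (v : Fin s → L) :
    φ (∑ σ ∈ shufflesAlong (leftBlock h) (rightBlock h) with ∃ a, σ (leftBlock h a) = 0,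
      ((Equiv.Perm.sign σ : ℤˣ) : ℤ) •
        (η₁ (fun a => (Fin.cons x fun u => α.symm (v u) : Fin (s + 1) → L) (σ (leftBlock h a))) *
          η₂ fun b => (Fin.cons x fun u => α.symm (v u) : Fin (s + 1) → L)
            (σ (rightBlock h b)))) =
      wedgeF (m - 1) k (ixF φ α x m (ofAlt m η₁)) (PhiF φ α (ofAlt k η₂)) s v := by
  cases m with
  | zero => simp [wedgeF, ixF]
  | succ m =>
    have h' : s = m + k := by omega
    have h0 : leftBlock h 0 = 0 := by ext; simp [leftBlock]
    rw [sum_shufflesAlong_exists_eq_zero (l' := leftBlock h') (r' := rightBlock h'),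
      Nat.add_sub_cancel, wedgeF_apply h', h0]
    · simp only [Fin.val_zero, pow_zero, one_smul, map_sum, map_zsmul, map_mul]
      refine Finset.sum_congr rfl fun τ _ => ?_
      simp only [ixF, PhiF, ofAlt_self, dif_pos, Fin.cast_eq_self]
    · intro a
      rw [h0]
      ext
      simp [leftBlock]
    · intro b
      rw [h0]
      ext
      simp [rightBlock]
      omega

/-- The part of the contraction of a wedge product in which the contracted vector is inserted
into the right factor. -/
theorem map_sum_exists_rightBlock {R A L : Type*} [CommRing R] [CommRing A] [Algebra R A]
    [AddCommGroup L] [Module R L] [Module A L] (φ : A ≃ₐ[R] A) (α : L ≃ₗ[R] L) {m k s : ℕ}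
    (h : s + 1 = m + k) (η₁ : AlternatingMap A L A (Fin m)) (η₂ : AlternatingMap A L A (Fin k))
    (x : L) (v : Fin s → L) :
    φ (∑ σ ∈ shufflesAlong (leftBlock h) (rightBlock h) with ∃ b, σ (rightBlock h b) = 0,
      ((Equiv.Perm.sign σ : ℤˣ) : ℤ) •
        (η₁ (fun a => (Fin.cons x fun u => α.symm (v u) : Fin (s + 1) → L) (σ (leftBlock h a))) *
          η₂ fun b => (Fin.cons x fun u => α.symm (v u) : Fin (s + 1) → L)
            (σ (rightBlock h b)))) =
      ((-1 : ℤ) ^ m) •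
        wedgeF m (k - 1) (PhiF φ α (ofAlt m η₁)) (ixF φ α x k (ofAlt k η₂)) s v := by
  cases k with
  | zero => simp [wedgeF, ixF]
  | succ k =>
    have h' : s = m + k := by omega
    have h0 : (rightBlock h 0 : ℕ) = m := by simp [rightBlock]
    simp only [mul_comm (η₁ _), shufflesAlong_comm (leftBlock h)]
    rw [sum_shufflesAlong_exists_eq_zero (l' := rightBlock h') (r' := leftBlock h'),
      Nat.add_sub_cancel, wedgeF_apply h', h0, shufflesAlong_comm (leftBlock h')]
    · simp only [map_sum, map_zsmul, map_mul]
      congr 1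
      refine Finset.sum_congr rfl fun τ _ => ?_
      simp only [ixF, PhiF, ofAlt_self, dif_pos, Fin.cast_eq_self, mul_comm]
    · intro b
      rw [Fin.succAbove_of_le_castSucc _ _ (by simp [Fin.le_def, rightBlock])]
      ext
      simp [rightBlock]
      omega
    · intro a
      rw [Fin.succAbove_of_castSucc_lt _ _ (by simp [Fin.lt_def, leftBlock, rightBlock])]
      ext
      simp [leftBlock]

/-- For a regular hom-Lie-Rinehart algebra `(L,α)` over `(A,φ)`, every
`x ∈ L`, `η₁ ∈ Alt_A^m(L,A)` and `η₂ ∈ Alt_A^k(L,A)` satisfy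
`i_x(η₁ ∧ η₂) = i_x(η₁) ∧ Φ(η₂) + (−1)^m Φ(η₁) ∧ i_x(η₂)`. -/
theorem contraction_wedge_formula
    {R A L : Type*} [CommRing R] [CommRing A] [Algebra R A]
    [AddCommGroup L] [Module R L] [Module A L] [IsScalarTower R A L]
    -- the regular hom-Lie-Rinehart algebra structure
    (φ : A ≃ₐ[R] A)
    (br : L →ₗ[R] L →ₗ[R] L)
    (α : L ≃ₗ[R] L)
    (ρ : L →ₗ[R] A →ₗ[R] A)
    (hskew : ∀ x y : L, br x y = - br y x)
    (hα_br : ∀ x y : L, α (br x y) = br (α x) (α y))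
    (hjacobi : ∀ x y z : L,
      br (α x) (br y z) + br (α y) (br z x) + br (α z) (br x y) = 0)
    (hα_smul : ∀ (a : A) (x : L), α (a • x) = φ a • α x)
    (hρ_smul : ∀ (a : A) (x : L) (b : A), ρ (a • x) b = φ a * ρ x b)
    (hρ_der : ∀ (x : L) (a b : A), ρ x (a * b) = φ a * ρ x b + φ b * ρ x a)
    (hρ_rep1 : ∀ (x : L) (a : A), ρ (α x) (φ a) = φ (ρ x a))
    (hρ_rep2 : ∀ (x y : L) (a : A),
      ρ (br x y) (φ a) = ρ (α x) (ρ y a) - ρ (α y) (ρ x a))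
    (hleibniz : ∀ (x : L) (a : A) (y : L),
      br x (a • y) = φ a • br x y + ρ x a • α y) :
    ∀ (m k : ℕ) (η₁ : AlternatingMap A L A (Fin m)) (η₂ : AlternatingMap A L A (Fin k))
      (x : L) (s : ℕ) (v : Fin s → L),
      ixF φ α x (m + k) (wedgeF m k (ofAlt m η₁) (ofAlt k η₂)) s v
        = wedgeF (m - 1) k (ixF φ α x m (ofAlt m η₁)) (PhiF φ α (ofAlt k η₂)) s v
          + ((-1 : ℤ) ^ m) •
              wedgeF m (k - 1) (PhiF φ α (ofAlt m η₁)) (ixF φ α x k (ofAlt k η₂)) s v := by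
  intro m k η₁ η₂ x s v
  by_cases h : s + 1 = m + k
  · rw [← map_sum_exists_leftBlock φ α h, ← map_sum_exists_rightBlock φ α h, ← map_add,
      ← Finset.filter_congr fun σ _ => not_exists_leftBlock_iff h σ,
      Finset.sum_filter_add_sum_filter_not, ixF, dif_pos h, wedgeF_cast h, wedgeF_apply h]
    simp only [ofAlt_self]
  · rw [ixF, dif_neg h]
    have h1 : wedgeF (m - 1) k (ixF φ α x m (ofAlt m η₁)) (PhiF φ α (ofAlt k η₂)) s v = 0 := by
      cases m with
      | zero => simp [wedgeF, ixF]
      | succ m => exact dif_neg (by omega)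
    have h2 : wedgeF m (k - 1) (PhiF φ α (ofAlt m η₁)) (ixF φ α x k (ofAlt k η₂)) s v = 0 := by
      cases k with
      | zero => simp [wedgeF, ixF]
      | succ k => exact dif_neg (by omega)
    rw [h1, h2, smul_zero, add_zero]
end

section
/- Let (L,α) be a hom-Lie-Rinehart algebra over (A,φ) with φ an algebra automorphism, and assume 2 is invertible in A. Let E be a free A-module of rank 1 with basis t, let u ∈ A be a unit, and let β : E → E be the R-linear map β(a·t) = φ(a)·u·t (so β(a·s) = φ(a)·β(s) and β is bijective); set E² = E ⊗_A E and β̄ = β ⊗ β. Suppose ∇̄ : L × E² → E² is R-bilinear and satisfies, for all a ∈ A, x,y ∈ L, s ∈ E²: ∇̄(a·x, s) = φ(a)·∇̄(x,s); ∇̄(x, a·s) = φ(a)·∇̄(x,s) + ρ(x)(a)·β̄(s); ∇̄(α(x), β̄(s)) = β̄(∇̄(x,s)); and ∇̄([x,y], β̄(s)) = ∇̄(α(x), ∇̄(y,s)) − ∇̄(α(y), ∇̄(x,s)). For each x ∈ L let f_x ∈ A be the unique element with ∇̄(x, t⊗t) = f_x·β̄(t⊗t), and define ∇ : L × E → E by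 ∇(x, a·t) = ρ(x)(a)·β(t) + (1/2)·f_x·φ(a)·β(t). Then ∇ satisfies the four analogous axioms with (E,β) in place of (E²,β̄) — in particular ∇(α(x), β(s)) = β(∇(x,s)) and ∇([x,y], β(s)) = ∇(α(x), ∇(y,s)) − ∇(α(y), ∇(x,s)) — and moreover ∇̄(x, s_1 ⊗ s_2) = ∇(x,s_1) ⊗ β(s_2) + β(s_1) ⊗ ∇(x,s_2) for all s_1,s_2 ∈ E. -/
open TensorProduct

/-- (algebraic form of "a representation on the square of a line bundle
induces a representation on the line bundle") Let `(L,α)` be a hom-Lie-Rinehart algebra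
over `(A,φ)` with `φ` an automorphism and `2` invertible in `A`. Let `E` be a free
`A`-module of rank 1 with basis `t`, `u ∈ Aˣ`, and `β(a·t) = φ(a)·u·t`. If
`∇̄ : L × E⊗E → E⊗E` satisfies the four representation axioms for `(E², β̄ = β⊗β)`,
and `∇(x, a·t) := ρ(x)(a)·β(t) + ½·f_x·φ(a)·β(t)` where `∇̄(x,t⊗t) = f_x·β̄(t⊗t)`,
then `∇` satisfies the four analogous axioms for `(E,β)` and
`∇̄(x, s₁⊗s₂) = ∇(x,s₁)⊗β(s₂) + β(s₁)⊗∇(x,s₂)`. -/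
theorem sqrt_representation_on_line_module
    {R A L E : Type*} [CommRing R] [CommRing A] [Algebra R A]
    [AddCommGroup L] [Module R L] [Module A L] [IsScalarTower R A L]
    [AddCommGroup E] [Module R E] [Module A E] [IsScalarTower R A E]
    -- the hom-Lie-Rinehart algebra structure, with `φ` an automorphism
    (φ : A ≃ₐ[R] A)
    (br : L →ₗ[R] L →ₗ[R] L)
    (α : L →ₗ[R] L)
    (ρ : L →ₗ[R] A →ₗ[R] A)
    (hskew : ∀ x y : L, br x y = - br y x)
    (hα_br : ∀ x y : L, α (br x y) = br (α x) (α y))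
    (hjacobi : ∀ x y z : L,
      br (α x) (br y z) + br (α y) (br z x) + br (α z) (br x y) = 0)
    (hα_smul : ∀ (a : A) (x : L), α (a • x) = φ a • α x)
    (hρ_smul : ∀ (a : A) (x : L) (b : A), ρ (a • x) b = φ a * ρ x b)
    (hρ_der : ∀ (x : L) (a b : A), ρ x (a * b) = φ a * ρ x b + φ b * ρ x a)
    (hρ_rep1 : ∀ (x : L) (a : A), ρ (α x) (φ a) = φ (ρ x a))
    (hρ_rep2 : ∀ (x y : L) (a : A),
      ρ (br x y) (φ a) = ρ (α x) (ρ y a) - ρ (α y) (ρ x a))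
    (hleibniz : ∀ (x : L) (a : A) (y : L),
      br x (a • y) = φ a • br x y + ρ x a • α y)
    -- `2` is invertible in `A`, with inverse `half`
    (half : A) (h2 : 2 * half = 1)
    -- `E` is free of rank one on the basis `t`
    (t : E) (hbasis : ∀ s : E, ∃! a : A, a • t = s)
    -- the unit `u` and the twist `β` of `E`, with `β(a·t) = φ(a)·u·t`
    (u : Aˣ)
    (β : E →ₗ[R] E)
    (hβ : ∀ a : A, β (a • t) = (φ a * u) • t)
    (hβ_smul : ∀ (a : A) (s : E), β (a • s) = φ a • β s)
    (hβ_bij : Function.Bijective β)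
    -- `β̄ = β ⊗ β` on `E² = E ⊗_A E`
    (βbar : (E ⊗[A] E) →ₗ[R] (E ⊗[A] E))
    (hβbar : ∀ s₁ s₂ : E, βbar (s₁ ⊗ₜ[A] s₂) = β s₁ ⊗ₜ[A] β s₂)
    -- the representation `∇̄` of `(L,α)` on `(E², β̄)`
    (Nb : L →ₗ[R] (E ⊗[A] E) →ₗ[R] (E ⊗[A] E))
    (hNb1 : ∀ (a : A) (x : L) (s : E ⊗[A] E), Nb (a • x) s = φ a • Nb x s)
    (hNb2 : ∀ (x : L) (a : A) (s : E ⊗[A] E),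
      Nb x (a • s) = φ a • Nb x s + ρ x a • βbar s)
    (hNb3 : ∀ (x : L) (s : E ⊗[A] E), Nb (α x) (βbar s) = βbar (Nb x s))
    (hNb4 : ∀ (x y : L) (s : E ⊗[A] E),
      Nb (br x y) (βbar s) = Nb (α x) (Nb y s) - Nb (α y) (Nb x s))
    -- `f_x` is the (unique) element with `∇̄(x, t⊗t) = f_x · β̄(t⊗t)`
    (f : L → A)
    (hf : ∀ x : L, Nb x (t ⊗ₜ[A] t) = f x • βbar (t ⊗ₜ[A] t))
    -- the induced map `∇` on `E`
    (nabla : L →ₗ[R] E →ₗ[R] E)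
    (hnabla : ∀ (x : L) (a : A),
      nabla x (a • t) = ρ x a • β t + (half * f x * φ a) • β t) :
    -- `∇` is a representation of `(L,α)` on `(E,β)` …
    (∀ (a : A) (x : L) (s : E), nabla (a • x) s = φ a • nabla x s) ∧
    (∀ (x : L) (a : A) (s : E), nabla x (a • s) = φ a • nabla x s + ρ x a • β s) ∧
    (∀ (x : L) (s : E), nabla (α x) (β s) = β (nabla x s)) ∧
    (∀ (x y : L) (s : E),
      nabla (br x y) (β s) = nabla (α x) (nabla y s) - nabla (α y) (nabla x s)) ∧
    -- … and squaring `∇` gives back `∇̄`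
    (∀ (x : L) (s₁ s₂ : E),
      Nb x (s₁ ⊗ₜ[A] s₂) = nabla x s₁ ⊗ₜ[A] β s₂ + β s₁ ⊗ₜ[A] nabla x s₂) := by
  have hsurj (s : E) : ∃ a : A, a • t = s := (hbasis s).exists
  obtain ⟨m, hm⟩ : ∃ m : E ⊗[A] E →ₗ[A] A, m (t ⊗ₜ[A] t) = 1 := by
    let e : A ≃ₗ[A] E := LinearEquiv.ofBijective (LinearMap.toSpanSingleton A E t)
      ((Function.bijective_iff_existsUnique _).2 hbasis)
    have he : e.symm t = 1 := e.symm_apply_eq.2 (one_smul A t).symm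
    exact ⟨LinearMap.mul' A A ∘ₗ TensorProduct.map e.symm.toLinearMap e.symm.toLinearMap,
      by simp [he]⟩
  have hcancel {a b : A} (h : a • (t ⊗ₜ[A] t) = b • (t ⊗ₜ[A] t)) : a = b := by
    simpa [hm] using congrArg m h
  have hβt : β t = (u : A) • t := by simpa using hβ 1
  have hβT (a : A) : βbar (a • (t ⊗ₜ[A] t)) = (φ a * u * u) • (t ⊗ₜ[A] t) := by
    rw [TensorProduct.smul_tmul', hβbar, hβ, hβt, TensorProduct.smul_tmul_smul]
  have hβT1 : βbar (t ⊗ₜ[A] t) = ((u : A) * u) • (t ⊗ₜ[A] t) := by simpa using hβT 1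
  have hNT (x : L) (a : A) :
      Nb x (a • (t ⊗ₜ[A] t)) = ((φ a * f x + ρ x a) * u * u) • (t ⊗ₜ[A] t) := by
    rw [hNb2, hf, hβT1, smul_smul, smul_smul, smul_smul, ← add_smul]
    congr 1
    ring
  have hn (x : L) (a : A) : nabla x (a • t) = ((ρ x a + half * f x * φ a) * u) • t := by
    rw [hnabla, hβt, smul_smul, smul_smul, ← add_smul]
    congr 1
    ring
  have hu : IsUnit (u : A) := u.isUnit
  have hφu : IsUnit (φ (u : A)) := hu.map φ
  have hφh : φ half = half := by
    have h : 2 * φ half = 1 := by simpa only [map_mul, map_ofNat, map_one] using congrArg φ h2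
    linear_combination half * h - φ half * h2
  have hρh (x : L) (b : A) : ρ x (half * b) = half * ρ x b := by
    have h : ρ x (half * b) + ρ x (half * b) = ρ x b := by
      rw [← map_add]
      congr 1
      linear_combination b * h2
    linear_combination half * h - ρ x (half * b) * h2
  have hf_smul (a : A) (x : L) : f (a • x) = φ a * f x := by
    have h := hNb1 a x (t ⊗ₜ[A] t)
    rw [hf, hf, hβT1, smul_smul, smul_smul, smul_smul] at h
    refine (hu.mul hu).mul_right_cancel ?_
    linear_combination hcancel h
  have hf_twist (x : L) : φ u * f (α x) + 2 * ρ (α x) u = φ u * φ (f x) := by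
    have h := hNb3 x (t ⊗ₜ[A] t)
    rw [hf, hβT1, smul_smul, hNT, hβT] at h
    have h' := hcancel h
    simp only [map_mul, hρ_der] at h'
    refine hφu.mul_left_cancel ((hu.mul hu).mul_right_cancel ?_)
    linear_combination h'
  have hf_br (x y : L) :
      φ u * f (br x y) + 2 * ρ (br x y) u = φ u * (ρ (α x) (f y) - ρ (α y) (f x)) := by
    have h := hNb4 x y (t ⊗ₜ[A] t)
    rw [hf, hf, hβT1, smul_smul, smul_smul, hNT, hNT, hNT, ← sub_smul] at h
    have h' := hcancel h
    simp only [map_mul, hρ_der] at h'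
    refine hφu.mul_left_cancel ((hu.mul hu).mul_right_cancel ?_)
    linear_combination h' + φ u * φ (f y) * u * u * hf_twist x
      - φ u * φ (f x) * u * u * hf_twist y
  refine ⟨fun a x s => ?_, fun x a s => ?_, fun x s => ?_, fun x y s => ?_, fun x s₁ s₂ => ?_⟩
  · obtain ⟨b, rfl⟩ := hsurj s
    rw [hn, hn, hρ_smul, hf_smul, smul_smul]
    congr 1
    ring
  · obtain ⟨b, rfl⟩ := hsurj s
    rw [smul_smul, hn, hn, hβ, smul_smul, smul_smul, ← add_smul, hρ_der, map_mul]
    congr 1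
    ring
  · obtain ⟨a, rfl⟩ := hsurj s
    rw [hβ, hn, hn, hβ]
    congr 1
    simp only [map_mul, map_add, hρ_der, hρ_rep1, hφh]
    linear_combination half * φ (φ a) * u * hf_twist x - φ (φ a) * u * ρ (α x) u * h2
  · obtain ⟨a, rfl⟩ := hsurj s
    rw [hβ, hn, hn, hn, hn, hn, ← sub_smul]
    congr 1
    simp only [mul_assoc half, add_mul, map_add, map_mul, hρh, hρ_der, hρ_rep1, hρ_rep2, hφh]
    linear_combination half * φ (φ a) * u * hf_br x y - φ (φ a) * u * ρ (br x y) u * h2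
      - (φ (ρ y a) + half * φ (f y) * φ (φ a)) * u * (half * hf_twist x - ρ (α x) u * h2)
      + (φ (ρ x a) + half * φ (f x) * φ (φ a)) * u * (half * hf_twist y - ρ (α y) u * h2)
  · obtain ⟨a, rfl⟩ := hsurj s₁
    obtain ⟨b, rfl⟩ := hsurj s₂
    rw [TensorProduct.smul_tmul_smul, hNT, hn, hn, hβ, hβ, TensorProduct.smul_tmul_smul,
      TensorProduct.smul_tmul_smul, ← add_smul, hρ_der, map_mul]
    congr 1
    linear_combination -φ a * φ b * f x * u * u * h2
end
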